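/- For a convex body K in ℝ^n, the classical illumination body I_δ(K) = {z ∈ ℝ^n : vol_n(conv({z} ∪ K) \ K) ≤ δ} is convex for every δ > 0. -/

import Mathlib

open MeasureTheory Set

/-- Moving a point `x` to `y = x + v` inside `convexHull ℝ (insert x K)` is a shadow system in the
direction `v`: along each fibre of a projection killing `v`, points of the hull with apex
`a • x + b • y` are convex combinations of points of the hulls with apexes `x` and `y`. -/
theorem exists_mem_convexHull_insert_fibre {E F : Type*} [AddCommGroup E] [Module ℝ E]
    [AddCommGroup F] [Module ℝ F] (e : E ≃ₗ[ℝ] ℝ × F) {K : Set E} (hK : Convex ℝ K)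
    (hne : K.Nonempty) {x y : E} (hxy : (e x).2 = (e y).2) {a b : ℝ}
    (hab : a + b = 1) {r : ℝ} {w : F}
    (hr : e.symm (r, w) ∈ convexHull ℝ (insert (a • x + b • y) K)) :
    ∃ p q : ℝ, e.symm (p, w) ∈ convexHull ℝ (insert x K) ∧
      e.symm (q, w) ∈ convexHull ℝ (insert y K) ∧ r = a * p + b * q := by
  have hull (u : E) : convexHull ℝ (insert u K) = convexJoin ℝ {u} K := by
    rw [convexHull_insert hne, hK.convexHull_eq]
  simp only [hull, mem_convexJoin, mem_singleton_iff, exists_eq_left] at hr ⊢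
  obtain ⟨k, hk, c, d, hc, hd, hcd, h⟩ := hr
  have he : c • (a • e x + b • e y) + d • e k = (r, w) := by
    rw [← e.apply_symm_apply (r, w), ← h]
    simp
  have h₁ : c * (a * (e x).1 + b * (e y).1) + d * (e k).1 = r := by
    simpa [mul_add] using congrArg Prod.fst he
  have hw : c • (e y).2 + d • (e k).2 = w := by
    have := congrArg Prod.snd he
    simpa only [Prod.snd_add, Prod.smul_snd, hxy, ← add_smul, hab, one_smul] using this
  refine ⟨c * (e x).1 + d * (e k).1, c * (e y).1 + d * (e k).1,
    ⟨k, hk, c, d, hc, hd, hcd, ?_⟩, ⟨k, hk, c, d, hc, hd, hcd, ?_⟩, ?_⟩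
  · rw [LinearEquiv.eq_symm_apply]
    ext <;> simp [hxy, ← hw]
  · rw [LinearEquiv.eq_symm_apply]
    ext <;> simp [← hw]
  · rw [← h₁]
    linear_combination (-d * (e k).1) * hab

/-- A convex set of reals containing two points has volume at least their distance. -/
theorem ofReal_sub_le_volume_of_convex {s : Set ℝ} (hs : Convex ℝ s) {p q : ℝ} (hp : p ∈ s)
    (hq : q ∈ s) : ENNReal.ofReal (q - p) ≤ volume s := by
  rw [← Real.volume_Icc]
  exact measure_mono (hs.ordConnected.out hp hq)

theorem volume_fibre_convexHull_insert_le {E F : Type*} [AddCommGroup E] [Module ℝ E]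
    [AddCommGroup F] [Module ℝ F] (e : E ≃ₗ[ℝ] ℝ × F) {K : Set E} (hK : Convex ℝ K)
    (hne : K.Nonempty) {x y : E} (hxy : (e x).2 = (e y).2) {a b : ℝ} (ha : 0 ≤ a) (hb : 0 ≤ b)
    (hab : a + b = 1) (w : F) :
    volume {r : ℝ | e.symm (r, w) ∈ convexHull ℝ (insert (a • x + b • y) K)} ≤
      ENNReal.ofReal a * volume {r : ℝ | e.symm (r, w) ∈ convexHull ℝ (insert x K)} +
      ENNReal.ofReal b * volume {r : ℝ | e.symm (r, w) ∈ convexHull ℝ (insert y K)} := by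
  have hconv (u : E) : Convex ℝ {r : ℝ | e.symm (r, w) ∈ convexHull ℝ (insert u K)} := by
    intro r hr s hs c d hc hd hcd
    have := convex_convexHull ℝ (insert u K) hr hs hc hd hcd
    rw [← map_smul, ← map_smul, ← map_add] at this
    simpa [← add_smul, hcd] using this
  refine (Real.volume_le_diam _).trans (Metric.ediam_le fun r hr s hs => ?_)
  wlog hrs : s ≤ r generalizing r s
  · rw [edist_comm]
    exact this s hs r hr (le_of_not_ge hrs)
  obtain ⟨p, q, hp, hq, rfl⟩ := exists_mem_convexHull_insert_fibre e hK hne hxy hab hr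
  obtain ⟨p', q', hp', hq', rfl⟩ := exists_mem_convexHull_insert_fibre e hK hne hxy hab hs
  rw [edist_dist, Real.dist_eq, abs_of_nonneg (sub_nonneg.2 hrs)]
  calc ENNReal.ofReal (a * p + b * q - (a * p' + b * q'))
      = ENNReal.ofReal (a * (p - p') + b * (q - q')) := by ring_nf
    _ ≤ ENNReal.ofReal (a * (p - p')) + ENNReal.ofReal (b * (q - q')) := ENNReal.ofReal_add_le
    _ = ENNReal.ofReal a * ENNReal.ofReal (p - p') +
          ENNReal.ofReal b * ENNReal.ofReal (q - q') := by
        rw [ENNReal.ofReal_mul ha, ENNReal.ofReal_mul hb]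
    _ ≤ _ := by
        gcongr
        · exact ofReal_sub_le_volume_of_convex (hconv x) hp' hp
        · exact ofReal_sub_le_volume_of_convex (hconv y) hq' hq

theorem isCompact_convexJoin {E : Type*} [AddCommGroup E] [Module ℝ E] [TopologicalSpace E]
    [IsTopologicalAddGroup E] [ContinuousSMul ℝ E] {s t : Set E} (hs : IsCompact s)
    (ht : IsCompact t) : IsCompact (convexJoin ℝ s t) := by
  have h : convexJoin ℝ s t =
      (fun p : E × E × ℝ => AffineMap.lineMap p.1 p.2.1 p.2.2) '' (s ×ˢ t ×ˢ Icc 0 1) := by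
    ext z
    simp [mem_convexJoin, segment_eq_image_lineMap, and_assoc]
  rw [h]
  refine (hs.prod (ht.prod isCompact_Icc)).image ?_
  simp only [AffineMap.lineMap_apply_module]
  fun_prop

/-- The volume of the convex hull of `K` and a point is a convex function of the point. -/
theorem measure_convexHull_insert_le {E : Type*} [NormedAddCommGroup E] [NormedSpace ℝ E]
    [FiniteDimensional ℝ E] [MeasurableSpace E] [BorelSpace E] (μ : Measure E)
    [μ.IsAddHaarMeasure] {K : Set E} (hKc : IsCompact K) (hK : Convex ℝ K) (hne : K.Nonempty)
    (x y : E) {a b : ℝ} (ha : 0 ≤ a) (hb : 0 ≤ b) (hab : a + b = 1) :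
    μ (convexHull ℝ (insert (a • x + b • y) K)) ≤
      ENNReal.ofReal a * μ (convexHull ℝ (insert x K)) +
      ENNReal.ofReal b * μ (convexHull ℝ (insert y K)) := by
  obtain rfl | hv := eq_or_ne x y
  · rw [← add_smul, hab, one_smul, ← add_mul, ← ENNReal.ofReal_add ha hb, hab, ENNReal.ofReal_one,
      one_mul]
  obtain ⟨f, hf⟩ := SeparatingDual.exists_eq_one (R := ℝ) (sub_ne_zero.2 hv.symm)
  let e : E ≃L[ℝ] ℝ × f.ker := ContinuousLinearEquiv.equivOfRightInverse f
    (ContinuousLinearMap.toSpanSingleton ℝ (y - x)) (fun t => by simp [hf])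
  have hxy : (e x).2 = (e y).2 := by
    have h : e (y - x) = (1, 0) := by
      rw [← e.eq_symm_apply]
      simp [e]
    rw [map_sub] at h
    exact (sub_eq_zero.1 (by simpa using congrArg Prod.snd h)).symm
  let ν : Measure f.ker := Measure.addHaar
  have hmap : (μ.map e).IsAddHaarMeasure := e.isAddHaarMeasure_map μ
  have hμ := Measure.isAddLeftInvariant_eq_smul (μ.map e) ((volume : Measure ℝ).prod ν)
  set c := Measure.addHaarScalarFactor (μ.map e) ((volume : Measure ℝ).prod ν)
  have hmeas (u : E) : MeasurableSet (e.symm ⁻¹' convexHull ℝ (insert u K)) := by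
    rw [convexHull_insert hne, hK.convexHull_eq]
    exact ((isCompact_convexJoin isCompact_singleton hKc).isClosed.preimage
      e.symm.continuous).measurableSet
  have hvol (u : E) : μ (convexHull ℝ (insert u K)) =
      c * ∫⁻ w, volume {r : ℝ | e.symm (r, w) ∈ convexHull ℝ (insert u K)} ∂ν := by
    have h : μ (convexHull ℝ (insert u K)) =
        μ.map e (e.symm ⁻¹' convexHull ℝ (insert u K)) := by
      rw [Measure.map_apply e.continuous.measurable (hmeas u), ← preimage_comp]
      simp
    rw [h, hμ, Measure.smul_apply, Measure.prod_apply_symm (hmeas u)]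
    rfl
  have hfib (u : E) :
      Measurable fun w => volume {r : ℝ | e.symm (r, w) ∈ convexHull ℝ (insert u K)} :=
    measurable_measure_prodMk_right (hmeas u)
  rw [hvol, hvol, hvol, mul_left_comm, mul_left_comm (ENNReal.ofReal b), ← mul_add,
    ← lintegral_const_mul _ (hfib x), ← lintegral_const_mul _ (hfib y),
    ← lintegral_add_left ((hfib x).const_mul _)]
  gcongr with w
  exact volume_fibre_convexHull_insert_le e.toLinearEquiv hK hne hxy ha hb hab w

/-- the classical illumination body
`I_δ(K) = {z : vol(conv({z} ∪ K) \ K) ≤ δ}` is convex for every `δ > 0`. -/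
theorem illuminationBody_convex (n : ℕ)
    (K : Set (EuclideanSpace ℝ (Fin n)))
    (hKc : IsCompact K) (hKconv : Convex ℝ K) (hKint : (interior K).Nonempty)
    (δ : ℝ) (hδ : 0 < δ) :
    Convex ℝ {z : EuclideanSpace ℝ (Fin n) |
      volume (convexHull ℝ ({z} ∪ K) \ K) ≤ ENNReal.ofReal δ} := by
  have hdiff (z : EuclideanSpace ℝ (Fin n)) :
      volume (convexHull ℝ ({z} ∪ K) \ K) ≤ ENNReal.ofReal δ ↔
        volume (convexHull ℝ (insert z K)) ≤ ENNReal.ofReal δ + volume K := by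
    rw [singleton_union, measure_sdiff ((subset_insert z K).trans (subset_convexHull ℝ _))
      hKc.measurableSet.nullMeasurableSet hKc.measure_ne_top, tsub_le_iff_right]
  simp only [hdiff]
  intro x hx y hy a b ha hb hab
  calc volume (convexHull ℝ (insert (a • x + b • y) K))
      ≤ ENNReal.ofReal a * volume (convexHull ℝ (insert x K)) +
          ENNReal.ofReal b * volume (convexHull ℝ (insert y K)) :=
        measure_convexHull_insert_le volume hKc hKconv (hKint.mono interior_subset) x y ha hb hab
    _ ≤ ENNReal.ofReal a * (ENNReal.ofReal δ + volume K) +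
          ENNReal.ofReal b * (ENNReal.ofReal δ + volume K) := by
        gcongr
        exacts [hx, hy]
    _ = ENNReal.ofReal δ + volume K := by
        rw [← add_mul, ← ENNReal.ofReal_add ha hb, hab, ENNReal.ofReal_one, one_mul]
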